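/- Retrospective shrinkage decomposition (equations (18)–(20)). Let 0<Θ<1, λ₀>0, λ₁>0, φ₀∈ℝ and |φ₁|<1, let θ(β) = Θ·ψ₁ST(β)/(Θ·ψ₁ST(β)+(1−Θ)·ψ₀(β|λ₀)), fix a future value b∈ℝ, and define μ(β) = φ₀+φ₁(β−φ₀), p*(β) = θ(β)·N(b; μ(β), λ₁) / [θ(β)·N(b; μ(β), λ₁) + (1−θ(β))·ψ₀(b|λ₀)], and the retrospective penalty g(β) = log[ (1−θ(β))·ψ₀(b|λ₀) + θ(β)·N(b; μ(β), λ₁) ]. Then for every β≠0, g is differentiable at β with derivative g'(β) = [λ₀·sign(β) − (β−φ₀)·(1−φ₁²)/λ₁]·(p*(β) − θ(β)) + p*(β)·φ₁·(b−μ(β))/λ₁. -/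

import Mathlib

open MeasureTheory Real

/-- Laplace density with rate `lam`. -/
noncomputable def laplacePdf (lam β : ℝ) : ℝ := (lam / 2) * Real.exp (-(lam * |β|))

/-- Gaussian density with mean `m` and variance `v`. -/
noncomputable def gaussPdf (m v β : ℝ) : ℝ :=
  (1 / Real.sqrt (2 * Real.pi * v)) * Real.exp (-((β - m) ^ 2) / (2 * v))

/-- Stationary slab density: Gaussian with mean `φ0` and variance `λ1/(1-φ1²)`. -/
noncomputable def psi1ST (l1 φ0 φ1 β : ℝ) : ℝ := gaussPdf φ0 (l1 / (1 - φ1 ^ 2)) β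

/-- Evolving mixing weight `θ(β)`. -/
noncomputable def mixW (Θ l0 l1 φ0 φ1 β : ℝ) : ℝ :=
  Θ * psi1ST l1 φ0 φ1 β / (Θ * psi1ST l1 φ0 φ1 β + (1 - Θ) * laplacePdf l0 β)

/-- Slab conditional mean `μ(β) = φ0 + φ1(β − φ0)`. -/
noncomputable def slabMean (φ0 φ1 β : ℝ) : ℝ := φ0 + φ1 * (β - φ0)

/-- Conditional slab probability `p*(β)` for a fixed future value `b`. -/
noncomputable def pStarRetro (Θ l0 l1 φ0 φ1 b β : ℝ) : ℝ :=
  mixW Θ l0 l1 φ0 φ1 β * gaussPdf (slabMean φ0 φ1 β) l1 b /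
    (mixW Θ l0 l1 φ0 φ1 β * gaussPdf (slabMean φ0 φ1 β) l1 b +
      (1 - mixW Θ l0 l1 φ0 φ1 β) * laplacePdf l0 b)

/-- Retrospective penalty `g(β) = log[(1−θ(β))ψ₀(b|λ₀) + θ(β)N(b; μ(β), λ₁)]`. -/
noncomputable def retroPen (Θ l0 l1 φ0 φ1 b β : ℝ) : ℝ :=
  Real.log ((1 - mixW Θ l0 l1 φ0 φ1 β) * laplacePdf l0 b +
    mixW Θ l0 l1 φ0 φ1 β * gaussPdf (slabMean φ0 φ1 β) l1 b)

lemma laplacePdf_pos {lam : ℝ} (h : 0 < lam) (β : ℝ) : 0 < laplacePdf lam β := by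
  unfold laplacePdf; positivity

lemma gaussPdf_pos {v : ℝ} (h : 0 < v) (m β : ℝ) : 0 < gaussPdf m v β := by
  unfold gaussPdf; positivity

lemma hasDerivAt_abs_real_sign {β : ℝ} (hβ : β ≠ 0) :
    HasDerivAt (fun x : ℝ => |x|) (Real.sign β) β := by
  rcases lt_or_gt_of_ne hβ with h | h
  · simpa [Real.sign_of_neg h] using hasDerivAt_abs_neg h
  · simpa [Real.sign_of_pos h] using hasDerivAt_abs_pos h

lemma hasDerivAt_laplacePdf (lam : ℝ) {β : ℝ} (hβ : β ≠ 0) :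
    HasDerivAt (laplacePdf lam) (-(lam * Real.sign β) * laplacePdf lam β) β := by
  have h := (((hasDerivAt_abs_real_sign hβ).const_mul lam).neg.exp).const_mul (lam / 2)
  refine h.congr_deriv ?_
  simp only [laplacePdf, Pi.neg_apply]
  ring

/-- Derivative of a Gaussian density along moving mean and argument. -/
lemma HasDerivAt.gaussPdf {m y : ℝ → ℝ} {m' y' β : ℝ} (v : ℝ)
    (hm : HasDerivAt m m' β) (hy : HasDerivAt y y' β) :
    HasDerivAt (fun x => gaussPdf (m x) v (y x))
      (-((y β - m β) * (y' - m') / v) * _root_.gaussPdf (m β) v (y β)) β := by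
  have h := ((((hy.sub hm).pow 2).neg.div_const (2 * v)).exp).const_mul
    (1 / Real.sqrt (2 * Real.pi * v))
  refine h.congr_deriv ?_
  simp only [_root_.gaussPdf, Pi.neg_apply, Pi.pow_apply, Pi.sub_apply]
  ring

lemma hasDerivAt_psi1ST (l1 φ0 φ1 β : ℝ) :
    HasDerivAt (psi1ST l1 φ0 φ1)
      (-((β - φ0) * (1 - φ1 ^ 2) / l1) * psi1ST l1 φ0 φ1 β) β := by
  refine (HasDerivAt.gaussPdf (l1 / (1 - φ1 ^ 2))
    (hasDerivAt_const β φ0) (hasDerivAt_id β)).congr_deriv ?_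
  simp only [psi1ST, id, sub_zero, mul_one, div_div_eq_mul_div]

/-- Logistic-type derivative of a ratio `s / (s + t)` in terms of logarithmic derivatives. -/
lemma HasDerivAt.div_add_self {s t : ℝ → ℝ} {a c β : ℝ}
    (hs : HasDerivAt s (a * s β) β) (ht : HasDerivAt t (c * t β) β) (h : s β + t β ≠ 0) :
    HasDerivAt (fun x => s x / (s x + t x))
      ((a - c) * (s β / (s β + t β) * (1 - s β / (s β + t β)))) β := by
  refine (hs.div (hs.add ht) h).congr_deriv ?_
  simp only [Pi.add_apply]
  field_simp
  ring

lemma one_sub_sq_pos_of_abs_lt_one {x : ℝ} (h : |x| < 1) : 0 < 1 - x ^ 2 :=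
  sub_pos.2 ((sq_lt_one_iff_abs_lt_one x).2 h)

lemma mixW_mem_Ioo {Θ l0 l1 φ1 : ℝ} (hΘ0 : 0 < Θ) (hΘ1 : Θ < 1) (hl0 : 0 < l0)
    (hl1 : 0 < l1) (hφ1 : |φ1| < 1) (φ0 β : ℝ) :
    mixW Θ l0 l1 φ0 φ1 β ∈ Set.Ioo (0 : ℝ) 1 := by
  have hs : 0 < Θ * psi1ST l1 φ0 φ1 β :=
    mul_pos hΘ0 (gaussPdf_pos (div_pos hl1 (one_sub_sq_pos_of_abs_lt_one hφ1)) _ _)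
  have ht : 0 < (1 - Θ) * laplacePdf l0 β := mul_pos (sub_pos.2 hΘ1) (laplacePdf_pos hl0 β)
  exact ⟨div_pos hs (add_pos hs ht), (div_lt_one (add_pos hs ht)).2 (lt_add_of_pos_right _ ht)⟩

lemma hasDerivAt_mixW {Θ l0 l1 φ1 : ℝ} (hΘ0 : 0 < Θ) (hΘ1 : Θ < 1) (hl0 : 0 < l0)
    (hl1 : 0 < l1) (hφ1 : |φ1| < 1) (φ0 : ℝ) {β : ℝ} (hβ : β ≠ 0) :
    HasDerivAt (mixW Θ l0 l1 φ0 φ1)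
      ((l0 * Real.sign β - (β - φ0) * (1 - φ1 ^ 2) / l1) *
        (mixW Θ l0 l1 φ0 φ1 β * (1 - mixW Θ l0 l1 φ0 φ1 β))) β := by
  have hs : 0 < Θ * psi1ST l1 φ0 φ1 β :=
    mul_pos hΘ0 (gaussPdf_pos (div_pos hl1 (one_sub_sq_pos_of_abs_lt_one hφ1)) _ _)
  have ht : 0 < (1 - Θ) * laplacePdf l0 β := mul_pos (sub_pos.2 hΘ1) (laplacePdf_pos hl0 β)
  have hs' := ((hasDerivAt_psi1ST l1 φ0 φ1 β).const_mul Θ).congr_deriv (mul_left_comm _ _ _)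
  have ht' := ((hasDerivAt_laplacePdf l0 hβ).const_mul (1 - Θ)).congr_deriv (mul_left_comm _ _ _)
  refine (HasDerivAt.div_add_self hs' ht' (add_pos hs ht).ne').congr_deriv ?_
  rw [mixW]
  ring

/-- Retrospective shrinkage decomposition (equations (18)–(20)): for `β ≠ 0`,
`g'(β) = [λ₀·sign(β) − (β−φ₀)(1−φ₁²)/λ₁]·(p*(β) − θ(β)) + p*(β)·φ₁·(b−μ(β))/λ₁`. -/
theorem retrospective_shrinkage_decomposition
    (Θ l0 l1 φ0 φ1 b : ℝ)
    (hΘ0 : 0 < Θ) (hΘ1 : Θ < 1) (hl0 : 0 < l0) (hl1 : 0 < l1) (hφ1 : |φ1| < 1) :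
    ∀ β : ℝ, β ≠ 0 →
      HasDerivAt (fun x => retroPen Θ l0 l1 φ0 φ1 b x)
        ((l0 * Real.sign β - (β - φ0) * (1 - φ1 ^ 2) / l1) *
            (pStarRetro Θ l0 l1 φ0 φ1 b β - mixW Θ l0 l1 φ0 φ1 β) +
          pStarRetro Θ l0 l1 φ0 φ1 b β * φ1 * (b - slabMean φ0 φ1 β) / l1) β := by
  intro β hβ
  obtain ⟨hθ0, hθ1⟩ := mixW_mem_Ioo hΘ0 hΘ1 hl0 hl1 hφ1 φ0 β
  have hθ := hasDerivAt_mixW hΘ0 hΘ1 hl0 hl1 hφ1 φ0 hβ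
  have hμ : HasDerivAt (slabMean φ0 φ1) φ1 β :=
    ((((hasDerivAt_id β).sub_const φ0).const_mul φ1).const_add φ0).congr_deriv (mul_one φ1)
  have hN := HasDerivAt.gaussPdf l1 hμ (hasDerivAt_const β b)
  have hL : 0 < laplacePdf l0 b := laplacePdf_pos hl0 b
  have hNpos : 0 < gaussPdf (slabMean φ0 φ1 β) l1 b := gaussPdf_pos hl1 _ _
  have hD : 0 < (1 - mixW Θ l0 l1 φ0 φ1 β) * laplacePdf l0 b +
      mixW Θ l0 l1 φ0 φ1 β * gaussPdf (slabMean φ0 φ1 β) l1 b :=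
    add_pos (mul_pos (sub_pos.2 hθ1) hL) (mul_pos hθ0 hNpos)
  refine ((((hθ.const_sub 1).mul_const (laplacePdf l0 b)).add (hθ.mul hN)).log
    hD.ne').congr_deriv ?_
  simp only [pStarRetro, Pi.add_apply, Pi.mul_apply]
  rw [add_comm (mixW Θ l0 l1 φ0 φ1 β * gaussPdf (slabMean φ0 φ1 β) l1 b)]
  generalize l0 * Real.sign β - (β - φ0) * (1 - φ1 ^ 2) / l1 = A
  generalize mixW Θ l0 l1 φ0 φ1 β = θ at *
  generalize gaussPdf (slabMean φ0 φ1 β) l1 b = N at *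
  generalize laplacePdf l0 b = L at *
  have hD' := hD.ne'
  field_simp
  ring
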